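/- Let u, d ∈ R^3 with u·d = 0, d ≠ 0, and suppose the coordinates of u are linearly independent over Q. Then for any δ > 0 and ε > 0 there exists a nonzero x ∈ Z^3 with dist(x, d) ≤ δ and |x·u| ≤ ε ||x||^{-γ}, where γ = (1+√5)/2 and dist(x,d) = ||x ∧ d||/(||x|| ||d||). -/

import Mathlib

noncomputable section

/-- Cross product in ℝ³. -/
def cross3 (x y : Fin 3 → ℝ) : Fin 3 → ℝ :=
  ![x 1 * y 2 - x 2 * y 1, x 2 * y 0 - x 0 * y 2, x 0 * y 1 - x 1 * y 0]

/-- Scalar product in ℝ³. -/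
def dot3 (x y : Fin 3 → ℝ) : ℝ := x 0 * y 0 + x 1 * y 1 + x 2 * y 2

/-- Euclidean norm in ℝ³. -/
def nrm (x : Fin 3 → ℝ) : ℝ := Real.sqrt (dot3 x x)

/-- Projective distance between nonzero vectors of ℝ³. -/
def pdist (x y : Fin 3 → ℝ) : ℝ := nrm (cross3 x y) / (nrm x * nrm y)

/-- The canonical map ℤ³ → ℝ³. -/
def toR (x : Fin 3 → ℤ) : Fin 3 → ℝ := fun i => (x i : ℝ)

/-- Determinant of three vectors of ℝ³. -/
def det3 (a b c : Fin 3 → ℝ) : ℝ :=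
  a 0 * (b 1 * c 2 - b 2 * c 1) - a 1 * (b 0 * c 2 - b 2 * c 0) + a 2 * (b 0 * c 1 - b 1 * c 0)

/-- Determinant of three vectors of ℤ³. -/
def det3Z (a b c : Fin 3 → ℤ) : ℤ :=
  a 0 * (b 1 * c 2 - b 2 * c 1) - a 1 * (b 0 * c 2 - b 2 * c 0) + a 2 * (b 0 * c 1 - b 1 * c 0)

/-- Cross product of integer vectors. -/
def crossZ (x y : Fin 3 → ℤ) : Fin 3 → ℤ :=
  ![x 1 * y 2 - x 2 * y 1, x 2 * y 0 - x 0 * y 2, x 0 * y 1 - x 1 * y 0]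

/-- A point of ℤ³ is primitive if its coordinates are coprime (in particular it is nonzero). -/
def IsPrimitive (x : Fin 3 → ℤ) : Prop := Int.gcd (Int.gcd (x 0) (x 1)) (x 2) = 1

/-- A pair of points of ℤ³ is primitive if their cross product is a primitive point. -/
def PrimPair (x y : Fin 3 → ℤ) : Prop := IsPrimitive (crossZ x y)

/-- The golden ratio. -/
def γ : ℝ := (1 + Real.sqrt 5) / 2


lemma mink (a b c : Fin 3 → ℝ) (hdet : |det3 a b c| = 1) (A B C : ℝ) (hA : 0 < A) (hB : 0 < B)
    (hC : 0 < C) (h : 1 < A * B * C) :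
    ∃ x : Fin 3 → ℤ, x ≠ 0 ∧ |dot3 (toR x) a| ≤ A ∧ |dot3 (toR x) b| ≤ B ∧
      |dot3 (toR x) c| ≤ C := by
  classical
  let M : Matrix (Fin 3) (Fin 3) ℝ := !![a 0, a 1, a 2; b 0, b 1, b 2; c 0, c 1, c 2]
  have hM : M.det = det3 a b c := by
    simp only [M, Matrix.det_fin_three, det3]
    simp
    ring
  let f : (Fin 3 → ℝ) →ₗ[ℝ] (Fin 3 → ℝ) := Matrix.toLin' M
  have hf : LinearMap.det f = det3 a b c := by rw [LinearMap.det_toLin', hM]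
  have hf0 : LinearMap.det f ≠ 0 := by
    rw [hf]; intro h0; rw [h0] at hdet; simp at hdet
  let v : Fin 3 → ℝ := ![A, B, C]
  let s : Set (Fin 3 → ℝ) := f ⁻¹' (Set.Icc (-v) v)
  have hvol : MeasureTheory.volume s = ENNReal.ofReal (8 * (A * B * C)) := by
    rw [MeasureTheory.Measure.addHaar_preimage_linearMap _ hf0, abs_inv, hf, hdet,
      Real.volume_Icc_pi]
    simp only [inv_one, ENNReal.ofReal_one, one_mul, Fin.prod_univ_three]
    simp only [v, Pi.neg_apply, Matrix.cons_val]
    rw [← ENNReal.ofReal_mul (by linarith), ← ENNReal.ofReal_mul (by nlinarith)]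
    congr 1
    ring
  let bs := Pi.basisFun ℝ (Fin 3)
  have fund := ZSpan.isAddFundamentalDomain bs MeasureTheory.volume
  have hF : MeasureTheory.volume (ZSpan.fundamentalDomain bs) = 1 := by
    have : Matrix.of (Pi.basisFun ℝ (Fin 3)) = (1 : Matrix (Fin 3) (Fin 3) ℝ) := by
      ext i j
      simp [Matrix.one_apply, Pi.single_apply, eq_comm]
    rw [ZSpan.volume_fundamentalDomain, this]
    simp
  have : Countable (Submodule.span ℤ (Set.range bs)).toAddSubgroup :=
    inferInstanceAs (Countable (Submodule.span ℤ (Set.range bs)))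
  obtain ⟨x, hx0, hxs⟩ :=
    MeasureTheory.exists_ne_zero_mem_lattice_of_measure_mul_two_pow_lt_measure (F := ZSpan.fundamentalDomain bs)
      (L := (Submodule.span ℤ (Set.range bs)).toAddSubgroup) fund (s := s)
    (by
      intro x hx
      simp only [s, Set.mem_preimage, map_neg, Set.mem_Icc] at hx ⊢
      exact ⟨neg_le_neg hx.2, neg_le.mp hx.1⟩)
    ((convex_Icc _ _).linear_preimage f)
    (by
      rw [hvol, hF]
      simp only [one_mul, Module.finrank_fin_fun]
      rw [show (2 : ENNReal) ^ 3 = ENNReal.ofReal 8 by norm_num]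
      rw [ENNReal.ofReal_lt_ofReal_iff (by nlinarith)]
      linarith)
  have hmem := (bs.mem_span_iff_repr_mem ℤ (x : Fin 3 → ℝ)).1 x.2
  choose z hz using hmem
  have hz' : toR z = (x : Fin 3 → ℝ) := by
    funext i
    have := hz i
    simpa [bs, toR] using this
  refine ⟨z, ?_, ?_⟩
  · rintro rfl
    apply hx0
    apply Subtype.ext
    rw [← hz']
    funext i
    simp [toR]
  · rw [hz']
    simp only [s, Set.mem_preimage, Set.mem_Icc, Pi.le_def] at hxs
    have e0 : f x 0 = dot3 x a := by
      simp [f, M, Matrix.mulVec, dotProduct, Fin.sum_univ_three, dot3]; ring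
    have e1 : f x 1 = dot3 x b := by
      simp [f, M, Matrix.mulVec, dotProduct, Fin.sum_univ_three, dot3]; ring
    have e2 : f x 2 = dot3 x c := by
      simp [f, M, Matrix.mulVec, dotProduct, Fin.sum_univ_three, dot3]; ring
    have h0 := hxs.1 0
    have h0' := hxs.2 0
    have h1 := hxs.1 1
    have h1' := hxs.2 1
    have h2 := hxs.1 2
    have h2' := hxs.2 2
    rw [e0] at h0 h0'
    rw [e1] at h1 h1'
    rw [e2] at h2 h2'
    simp only [v, Pi.neg_apply, Matrix.cons_val] at h0 h0' h1 h1' h2 h2'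
    exact ⟨abs_le.2 ⟨h0, h0'⟩, abs_le.2 ⟨h1, h1'⟩, abs_le.2 ⟨h2, h2'⟩⟩

lemma nrm_sq (v : Fin 3 → ℝ) : nrm v ^ 2 = dot3 v v := by
  unfold nrm
  apply Real.sq_sqrt
  unfold dot3
  nlinarith [sq_nonneg (v 0), sq_nonneg (v 1), sq_nonneg (v 2)]

lemma nrm_nonneg (v : Fin 3 → ℝ) : 0 ≤ nrm v := Real.sqrt_nonneg _

lemma one_le_nrm {x : Fin 3 → ℤ} (hx : x ≠ 0) : 1 ≤ nrm (toR x) := by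
  have h : (1 : ℤ) ≤ x 0 * x 0 + x 1 * x 1 + x 2 * x 2 := by
    by_contra hcon
    apply hx
    have h0 := mul_self_nonneg (x 0)
    have h1 := mul_self_nonneg (x 1)
    have h2 := mul_self_nonneg (x 2)
    have z0 : x 0 = 0 := mul_self_eq_zero.1 (by linarith)
    have z1 : x 1 = 0 := mul_self_eq_zero.1 (by linarith)
    have z2 : x 2 = 0 := mul_self_eq_zero.1 (by linarith)
    funext i
    fin_cases i
    · exact z0
    · exact z1
    · exact z2
  have h' : (1 : ℝ) ≤ dot3 (toR x) (toR x) := by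
    unfold dot3 toR
    exact_mod_cast h
  exact Real.one_le_sqrt.2 h'

lemma finite_ball (R : ℝ) : {x : Fin 3 → ℤ | nrm (toR x) ≤ R}.Finite := by
  apply (Set.finite_Icc (fun _ : Fin 3 => -⌈R⌉) (fun _ : Fin 3 => ⌈R⌉)).subset
  intro x hx
  have hx' : nrm (toR x) ≤ R := hx
  have hR : 0 ≤ R := (nrm_nonneg _).trans hx'
  have h2 : dot3 (toR x) (toR x) ≤ R ^ 2 := by
    rw [← nrm_sq]
    exact pow_le_pow_left₀ (nrm_nonneg _) hx' 2
  have key : ∀ i, |(x i : ℝ)| ≤ R := by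
    intro i
    apply abs_le_of_sq_le_sq _ hR
    unfold dot3 toR at h2
    fin_cases i <;> simp <;>
      nlinarith [sq_nonneg (x 0 : ℝ), sq_nonneg (x 1 : ℝ), sq_nonneg (x 2 : ℝ)]
  constructor
  · intro i
    have h := (abs_le.1 (key i)).1
    have h3 := Int.le_ceil R
    have : (-(⌈R⌉ : ℝ)) ≤ x i := by linarith
    exact_mod_cast this
  · intro i
    have h := (abs_le.1 (key i)).2
    have h3 := Int.le_ceil R
    have : (x i : ℝ) ≤ (⌈R⌉ : ℝ) := by linarith
    exact_mod_cast this

lemma gamma_sq : γ * γ = γ + 1 := by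
  unfold γ
  have := Real.mul_self_sqrt (show (0 : ℝ) ≤ 5 by norm_num)
  linarith

lemma gamma_gt : 1 < γ := by
  have h := gamma_sq
  have : 0 < γ := by unfold γ; positivity
  nlinarith

lemma gamma_lt : γ < 2 := by
  have h := gamma_sq
  have := gamma_gt
  nlinarith

/-- Expansion of the norm in the orthonormal basis. -/
lemma norm_expand (u d x : Fin 3 → ℝ) (huu : dot3 u u = 1) (hdd : dot3 d d = 1)
    (hud : dot3 u d = 0) :
    nrm x ^ 2 = dot3 x d ^ 2 + dot3 x (cross3 u d) ^ 2 + dot3 x u ^ 2 := by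
  have key : dot3 x (cross3 u d) ^ 2 = dot3 x x * dot3 u u * dot3 d d
      + 2 * dot3 x u * dot3 x d * dot3 u d - dot3 x x * dot3 u d ^ 2
      - dot3 u u * dot3 x d ^ 2 - dot3 d d * dot3 x u ^ 2 := by
    simp only [dot3, cross3, Matrix.cons_val]
    ring
  rw [nrm_sq, key, huu, hdd, hud]
  ring

lemma cross_expand (u d x : Fin 3 → ℝ) (huu : dot3 u u = 1) (hdd : dot3 d d = 1)
    (hud : dot3 u d = 0) :
    nrm (cross3 x d) ^ 2 = dot3 x (cross3 u d) ^ 2 + dot3 x u ^ 2 := by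
  have key : dot3 (cross3 x d) (cross3 x d) = dot3 x x * dot3 d d - dot3 x d ^ 2 := by
    simp only [dot3, cross3, Matrix.cons_val]
    ring
  have h := norm_expand u d x huu hdd hud
  rw [nrm_sq] at h
  rw [nrm_sq, key, hdd]
  linarith

lemma det_basis (u d : Fin 3 → ℝ) (huu : dot3 u u = 1) (hdd : dot3 d d = 1)
    (hud : dot3 u d = 0) : det3 d (cross3 u d) u = 1 := by
  have key : det3 d (cross3 u d) u = dot3 u u * dot3 d d - dot3 u d ^ 2 := by
    simp only [dot3, cross3, det3, Matrix.cons_val]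
    ring
  rw [key, huu, hdd, hud]
  norm_num

lemma det_expand (u d w x y : Fin 3 → ℝ) (huu : dot3 u u = 1) (hdd : dot3 d d = 1)
    (hud : dot3 u d = 0) :
    det3 w x y =
      dot3 w d * (dot3 x (cross3 u d) * dot3 y u - dot3 x u * dot3 y (cross3 u d))
      - dot3 w (cross3 u d) * (dot3 x d * dot3 y u - dot3 x u * dot3 y d)
      + dot3 w u * (dot3 x d * dot3 y (cross3 u d) - dot3 x (cross3 u d) * dot3 y d) := by
  have h : det3 w x y * det3 d (cross3 u d) u = 
      dot3 w d * (dot3 x (cross3 u d) * dot3 y u - dot3 x u * dot3 y (cross3 u d))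
      - dot3 w (cross3 u d) * (dot3 x d * dot3 y u - dot3 x u * dot3 y d)
      + dot3 w u * (dot3 x d * dot3 y (cross3 u d) - dot3 x (cross3 u d) * dot3 y d) := by
    generalize cross3 u d = e
    simp only [dot3, det3]
    ring
  rw [← h, det_basis u d huu hdd hud, mul_one]

set_option maxHeartbeats 1000000 in
/-- The real-variable heart of the argument. -/
lemma poly_step (δ W X Y pw qw lw px qx lx py qy ly : ℝ) (hδ : 0 < δ) (hδ2 : δ ≤ 1 / 2)
    (hX : 1 ≤ X) (hW0 : 0 ≤ W) (hWX : W ≤ X) (hXY : X ≤ Y)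
    (hw : W ^ 2 = pw ^ 2 + qw ^ 2 + lw ^ 2) (hx : X ^ 2 = px ^ 2 + qx ^ 2 + lx ^ 2)
    (hy : Y ^ 2 = py ^ 2 + qy ^ 2 + ly ^ 2)
    (h1 : |lw| * X ^ 2 ≤ δ / 8) (h2 : |lx| * Y ^ 2 ≤ δ / 8) (h3 : |ly| ≤ |lx|)
    (hdet : 1 ≤ |pw * (qx * ly - lx * qy) - qw * (px * ly - lx * py) + lw * (px * qy - qx * py)|)
    (hdist : δ ^ 2 * X ^ 2 < qx ^ 2 + lx ^ 2) :
    ∃ a : ℤ, py - a * px ≠ 0 ∧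
      (qy - a * qx) ^ 2 + (ly - a * lx) ^ 2 ≤ δ ^ 2 * (py - a * px) ^ 2 ∧
      |ly - a * lx| ≤ 4 * Y / (δ * X) * |lx| ∧
      (py - a * px) ^ 2 + (qy - a * qx) ^ 2 + (ly - a * lx) ^ 2 ≤ (8 * Y / δ) ^ 2 := by
  have hX0 : 0 < X := by linarith
  have hY0 : 0 < Y := by linarith
  have hW2 : W ^ 2 ≤ X ^ 2 := pow_le_pow_left₀ hW0 hWX 2
  have bpw : |pw| ≤ X := abs_le_of_sq_le_sq (by linarith [sq_nonneg qw, sq_nonneg lw]) hX0.le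
  have bqw : |qw| ≤ X := abs_le_of_sq_le_sq (by linarith [sq_nonneg pw, sq_nonneg lw]) hX0.le
  have bpx : |px| ≤ X := abs_le_of_sq_le_sq (by linarith [sq_nonneg qx, sq_nonneg lx]) hX0.le
  have bqx : |qx| ≤ X := abs_le_of_sq_le_sq (by linarith [sq_nonneg px, sq_nonneg lx]) hX0.le
  have bpy : |py| ≤ Y := abs_le_of_sq_le_sq (by linarith [sq_nonneg qy, sq_nonneg ly]) hY0.le
  have bqy : |qy| ≤ Y := abs_le_of_sq_le_sq (by linarith [sq_nonneg py, sq_nonneg ly]) hY0.le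
  have hlx0 := abs_nonneg lx
  -- the two small terms of the determinant
  have small : ∀ a b c : ℝ, |a| ≤ X → |b| ≤ X → |c| ≤ Y →
      |a * (b * ly - lx * c)| ≤ δ / 4 := by
    intro a b c ha hb hc
    have e1 : |b * ly - lx * c| ≤ |b| * |ly| + |lx| * |c| := by
      rw [← abs_mul, ← abs_mul]; exact abs_sub _ _
    have e2 : |b| * |ly| ≤ Y * |lx| := mul_le_mul (by linarith) h3 (abs_nonneg _) hY0.le
    have e3 : |lx| * |c| ≤ |lx| * Y := mul_le_mul_of_nonneg_left hc hlx0
    rw [abs_mul]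
    calc |a| * |b * ly - lx * c| ≤ Y * (2 * Y * |lx|) := by
          apply mul_le_mul (by linarith) (by linarith) (abs_nonneg _) hY0.le
      _ = 2 * (|lx| * Y ^ 2) := by ring
      _ ≤ δ / 4 := by linarith
  have s1 := small pw qx qy bpw bqx bqy
  have s2 := small qw px py bqw bpx bpy
  set V := |px * qy - qx * py| with hV
  have hV0 : 0 ≤ V := abs_nonneg _
  have hlwV : 3 / 4 ≤ |lw| * V := by
    have e1 := abs_add_le (pw * (qx * ly - lx * qy) - qw * (px * ly - lx * py))
      (lw * (px * qy - qx * py))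
    have e2 := abs_sub (pw * (qx * ly - lx * qy)) (qw * (px * ly - lx * py))
    rw [abs_mul lw] at e1
    linarith
  have hVbig : 6 * X ^ 2 ≤ δ * V := by
    have : 3 / 4 * X ^ 2 ≤ |lw| * V * X ^ 2 := by gcongr
    have : |lw| * X ^ 2 * V ≤ δ / 8 * V := by gcongr
    linarith
  have hlxs : |lx| ≤ δ / 8 := by
    have : (1 : ℝ) ≤ Y ^ 2 := one_le_pow₀ (by linarith)
    exact (le_mul_of_one_le_right hlx0 this).trans h2
  have hqx : δ * X / 2 ≤ |qx| := by
    by_contra hcon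
    push Not at hcon
    have e1 : qx ^ 2 ≤ (δ * X / 2) ^ 2 := by
      rw [← sq_abs qx]
      exact pow_le_pow_left₀ (abs_nonneg _) hcon.le 2
    have e2 : lx ^ 2 ≤ (δ / 8) ^ 2 := by
      rw [← sq_abs lx]
      exact pow_le_pow_left₀ (abs_nonneg _) hlxs 2
    have e3 : δ ^ 2 ≤ δ ^ 2 * X ^ 2 := by
      have : (1 : ℝ) ≤ X ^ 2 := one_le_pow₀ hX
      exact le_mul_of_one_le_right (sq_nonneg δ) this
    have e4 : 0 < δ ^ 2 := by positivity
    have e5 : (δ * X / 2) ^ 2 = δ ^ 2 * X ^ 2 / 4 := by ring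
    have e6 : (δ / 8) ^ 2 = δ ^ 2 / 64 := by ring
    linarith
  have hqxpos : 0 < |qx| := lt_of_lt_of_le (by positivity) hqx
  have hqx0 : qx ≠ 0 := abs_pos.1 hqxpos
  have hYX : 1 ≤ Y / (δ * X) := by
    rw [le_div_iff₀ (by positivity)]
    nlinarith
  obtain ⟨a, ha⟩ : ∃ a : ℤ, a = round (qy / qx) := ⟨_, rfl⟩
  have hra : |qy / qx - a| ≤ 1 / 2 := by rw [ha]; exact abs_sub_round _
  have hqz : |qy - a * qx| ≤ |qx| / 2 := by
    have : qy - a * qx = (qy / qx - a) * qx := by field_simp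
    rw [this, abs_mul]
    nlinarith
  have haabs : |(a : ℝ)| ≤ 3 * (Y / (δ * X)) := by
    have e1 : |qy / qx| ≤ 2 * (Y / (δ * X)) := by
      rw [abs_div, div_le_iff₀ hqxpos]
      calc |qy| ≤ Y := bqy
        _ = 2 * (Y / (δ * X)) * (δ * X / 2) := by field_simp
        _ ≤ _ := by gcongr
    have e2 : |(a : ℝ)| ≤ |qy / qx| + |qy / qx - a| := by
      have := abs_sub (qy / qx) (qy / qx - a)
      simpa using this
    linarith
  have hlz : |ly - a * lx| ≤ 4 * Y / (δ * X) * |lx| := by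
    have e1 := abs_sub ly (a * lx)
    rw [abs_mul] at e1
    have e2 : |(a : ℝ)| * |lx| ≤ 3 * (Y / (δ * X)) * |lx| := by gcongr
    have e3 : 1 * |lx| ≤ Y / (δ * X) * |lx| := by gcongr
    calc _ ≤ _ := e1
      _ ≤ 4 * (Y / (δ * X)) * |lx| := by linarith
      _ = _ := by ring
  have hlzX : |ly - a * lx| ≤ X := by
    refine hlz.trans ?_
    have : 4 * Y / (δ * X) * |lx| = (4 / (δ * X * Y)) * (|lx| * Y ^ 2) := by field_simp
    rw [this]
    calc _ ≤ (4 / (δ * X * Y)) * (δ / 8) := by gcongr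
      _ = 1 / (2 * X * Y) := by field_simp; norm_num
      _ ≤ 1 := by
        rw [div_le_one (by positivity)]
        nlinarith
      _ ≤ X := hX
  have hpz : 2 * X ≤ δ * |py - a * px| := by
    have e1 : (px * qy - qx * py) = px * (qy - a * qx) - qx * (py - a * px) := by ring
    have e2 : V ≤ |px| * |qy - a * qx| + |qx| * |py - a * px| := by
      rw [hV, e1, ← abs_mul, ← abs_mul]; exact abs_sub _ _
    have e3 : |px| * |qy - a * qx| ≤ X * X := by
      apply mul_le_mul bpx (by linarith) (abs_nonneg _) hX0.le
    have e4 : |qx| * |py - a * px| ≤ X * |py - a * px| := by gcongr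
    have e5 : X * (6 * X) ≤ X * (δ * X + δ * |py - a * px|) := by
      have : δ * V ≤ δ * (X * X + X * |py - a * px|) := by
        apply mul_le_mul_of_nonneg_left _ hδ.le
        linarith
      nlinarith
    have e6 := le_of_mul_le_mul_left e5 hX0
    nlinarith
  have hpz0 : 0 < |py - a * px| := by
    by_contra hcon
    have : |py - a * px| = 0 := le_antisymm (not_lt.1 hcon) (abs_nonneg _)
    rw [this] at hpz
    linarith
  refine ⟨a, abs_pos.1 hpz0, ?_, hlz, ?_⟩
  · have e1 : (qy - a * qx) ^ 2 ≤ X ^ 2 := by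
      rw [← sq_abs]; exact pow_le_pow_left₀ (abs_nonneg _) (by linarith) 2
    have e2 : (ly - a * lx) ^ 2 ≤ X ^ 2 := by
      rw [← sq_abs]; exact pow_le_pow_left₀ (abs_nonneg _) hlzX 2
    have e3 : (2 * X) ^ 2 ≤ (δ * |py - a * px|) ^ 2 :=
      pow_le_pow_left₀ (by linarith) hpz 2
    rw [mul_pow δ, sq_abs] at e3
    have e4 : (2 * X) ^ 2 = 4 * X ^ 2 := by ring
    have e5 := sq_nonneg X
    linarith
  · have hYd : Y ≤ Y / δ := by
      rw [le_div_iff₀ hδ]; nlinarith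
    have e0 : |(a : ℝ)| * X ≤ 3 * (Y / δ) := by
      calc |(a : ℝ)| * X ≤ 3 * (Y / (δ * X)) * X := by gcongr
        _ = _ := by field_simp
    have e1 : |py - a * px| ≤ 4 * (Y / δ) := by
      have f1 := abs_sub py (a * px)
      rw [abs_mul] at f1
      have : |(a : ℝ)| * |px| ≤ |(a : ℝ)| * X := by gcongr
      linarith
    have e2 : |qy - a * qx| ≤ 4 * (Y / δ) := by linarith
    have e3 : |ly - a * lx| ≤ 4 * (Y / δ) := by linarith
    have g1 : (py - a * px) ^ 2 ≤ (4 * (Y / δ)) ^ 2 := by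
      rw [← sq_abs]; exact pow_le_pow_left₀ (abs_nonneg _) e1 2
    have g2 : (qy - a * qx) ^ 2 ≤ (4 * (Y / δ)) ^ 2 := by
      rw [← sq_abs]; exact pow_le_pow_left₀ (abs_nonneg _) e2 2
    have g3 : (ly - a * lx) ^ 2 ≤ (4 * (Y / δ)) ^ 2 := by
      rw [← sq_abs]; exact pow_le_pow_left₀ (abs_nonneg _) e3 2
    have : (8 * Y / δ) ^ 2 = 4 * (4 * (Y / δ)) ^ 2 := by ring
    rw [this]
    have g4 := sq_nonneg (4 * (Y / δ))
    linarith

lemma rpow_small (C s η : ℝ) (hs : s < 0) (hη : 0 < η) :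
    ∃ N : ℝ, 1 ≤ N ∧ ∀ T, N ≤ T → C * T ^ s ≤ η := by
  have h : Filter.Tendsto (fun T : ℝ => C * T ^ s) Filter.atTop (nhds 0) := by
    have := (tendsto_rpow_neg_atTop (y := -s) (by linarith)).const_mul C
    simpa using this
  have h2 := h.eventually (ge_mem_nhds hη)
  obtain ⟨N, hN⟩ := Filter.eventually_atTop.1 h2
  exact ⟨max N 1, le_max_right _ _, fun T hT => hN T ((le_max_left _ _).trans hT)⟩

/-- Under the negation of the theorem, uniform approximation with exponent `γ + 1`. -/
lemma star (u d : Fin 3 → ℝ) (huu : dot3 u u = 1) (hdd : dot3 d d = 1)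
    (hud : dot3 u d = 0) (δ ε : ℝ) (hδ : 0 < δ) (hδ2 : δ ≤ 1 / 2) (hε : 0 < ε)
    (H : ∀ x : Fin 3 → ℤ, x ≠ 0 → dot3 (toR x) (cross3 u d) ^ 2 + dot3 (toR x) u ^ 2 ≤
      δ ^ 2 * nrm (toR x) ^ 2 → ε * nrm (toR x) ^ (-γ) < |dot3 (toR x) u|) :
    ∃ D A : ℝ, 0 < D ∧ 0 < A ∧ ∀ T : ℝ, 1 ≤ T → ∃ x : Fin 3 → ℤ, x ≠ 0 ∧
      nrm (toR x) ≤ D * T ∧ |dot3 (toR x) u| ≤ A * T ^ (-(γ + 1)) := by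
  set A : ℝ := ε / 4 with hA
  set C : ℝ := 2 / A with hC
  have hA0 : 0 < A := by positivity
  have hC0 : 0 < C := by positivity
  have hg := gamma_gt
  refine ⟨(C + A) / δ, A, by positivity, hA0, ?_⟩
  intro T hT
  have hT0 : 0 < T := by linarith
  obtain ⟨x, hx0, hp, hq, hl⟩ := mink d (cross3 u d) u (by rw [det_basis u d huu hdd hud]; simp)
    (T ^ γ) (C * T) (A * T ^ (-(γ + 1))) (by positivity) (by positivity) (by positivity) (by
      have e1 : T ^ γ * (C * T) * (A * T ^ (-(γ + 1))) = (C * A) * (T ^ γ * T * T ^ (-(γ + 1))) := by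
        ring
      have e2 : T ^ γ * T * T ^ (-(γ + 1)) = 1 := by
        rw [Real.rpow_neg hT0.le, Real.rpow_add_one hT0.ne']
        field_simp
      have e3 : C * A = 2 := by rw [hC]; field_simp
      rw [e1, e2, e3]; norm_num)
  refine ⟨x, hx0, ?_, hl⟩
  have hn := norm_expand u d (toR x) huu hdd hud
  have hn1 := one_le_nrm hx0
  set n := nrm (toR x) with hndef
  set p := dot3 (toR x) d
  set q := dot3 (toR x) (cross3 u d)
  set l := dot3 (toR x) u
  have hTle : T ^ (-(γ + 1)) ≤ 1 := Real.rpow_le_one_of_one_le_of_nonpos hT (by linarith)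
  by_cases hc : q ^ 2 + l ^ 2 ≤ δ ^ 2 * n ^ 2
  · exfalso
    have h1 := H x hx0 hc
    have hδ3 : δ ^ 2 ≤ 1 / 4 := by nlinarith
    have h2 : n ^ 2 ≤ (2 * |p|) ^ 2 := by
      rw [mul_pow, sq_abs]
      have : δ ^ 2 * n ^ 2 ≤ 1 / 4 * n ^ 2 := by gcongr
      nlinarith [sq_nonneg p]
    have h3 : n ≤ 2 * |p| := le_of_sq_le_sq h2 (by positivity)
    have h4 : n ≤ 2 * T ^ γ := by linarith
    have h5 : (2 * T ^ γ) ^ (-γ) ≤ n ^ (-γ) :=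
      Real.rpow_le_rpow_of_nonpos (by linarith) h4 (by linarith)
    have h6 : (2 * T ^ γ) ^ (-γ) = 2 ^ (-γ) * T ^ (-(γ + 1)) := by
      rw [Real.mul_rpow (by norm_num) (by positivity), ← Real.rpow_mul hT0.le, mul_neg, gamma_sq]
    have h7 : (1 : ℝ) / 4 ≤ 2 ^ (-γ) := by
      have : (2 : ℝ) ^ (-2 : ℝ) ≤ 2 ^ (-γ) :=
        Real.rpow_le_rpow_of_exponent_le (by norm_num) (by linarith [gamma_lt])
      have e : (2 : ℝ) ^ (-2 : ℝ) = 1 / 4 := by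
        rw [Real.rpow_neg (by norm_num)]; norm_num
      exact e.symm.le.trans this
    have h8 : 1 / 4 * T ^ (-(γ + 1)) ≤ n ^ (-γ) := by
      refine le_trans ?_ h5
      rw [h6]
      gcongr
    have h9 : ε * (1 / 4 * T ^ (-(γ + 1))) ≤ ε * n ^ (-γ) := by gcongr
    have h10 : ε * (1 / 4 * T ^ (-(γ + 1))) = A * T ^ (-(γ + 1)) := by rw [hA]; ring
    linarith
  · push Not at hc
    have h1 : |l| ≤ A * T := by
      refine hl.trans ?_
      gcongr
      linarith
    have hq2 : q ^ 2 ≤ (C * T) ^ 2 := by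
      rw [← sq_abs]; exact pow_le_pow_left₀ (abs_nonneg _) hq 2
    have hl2 : l ^ 2 ≤ (A * T) ^ 2 := by
      rw [← sq_abs]; exact pow_le_pow_left₀ (abs_nonneg _) h1 2
    have h2 : (δ * n) ^ 2 ≤ ((C + A) * T) ^ 2 := by
      have e1 : ((C + A) * T) ^ 2 = (C * T) ^ 2 + (A * T) ^ 2 + 2 * (C * A * T ^ 2) := by ring
      have e2 : 0 ≤ C * A * T ^ 2 := by positivity
      rw [mul_pow]
      linarith
    have h3 : δ * n ≤ (C + A) * T := le_of_sq_le_sq h2 (by positivity)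
    rw [div_mul_eq_mul_div, le_div_iff₀ hδ]
    linarith

/-- The sequence of minimal points. -/
lemma minseq (u : Fin 3 → ℝ) (hL : ∀ x : Fin 3 → ℤ, x ≠ 0 → dot3 (toR x) u ≠ 0)
    (D A : ℝ) (hD : 0 < D)
    (hs : ∀ T : ℝ, 1 ≤ T → ∃ x : Fin 3 → ℤ, x ≠ 0 ∧
      nrm (toR x) ≤ D * T ∧ |dot3 (toR x) u| ≤ A * T ^ (-(γ + 1))) :
    ∃ (s : ℕ → Fin 3 → ℤ) (C : ℝ), 0 < C ∧ (∀ k, s k ≠ 0) ∧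
      (∀ k, |dot3 (toR (s (k + 1))) u| < |dot3 (toR (s k)) u|) ∧
      (∀ k, nrm (toR (s k)) ≤ nrm (toR (s (k + 1)))) ∧
      Filter.Tendsto (fun k => nrm (toR (s k))) Filter.atTop Filter.atTop ∧
      ∀ᶠ k in Filter.atTop, |dot3 (toR (s k)) u| ≤ C * nrm (toR (s (k + 1))) ^ (-(γ + 1)) := by
  have hg := gamma_gt
  have next : ∀ x : Fin 3 → ℤ, x ≠ 0 → ∃ y : Fin 3 → ℤ, y ≠ 0 ∧
      |dot3 (toR y) u| < |dot3 (toR x) u| ∧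
      ∀ z : Fin 3 → ℤ, z ≠ 0 → |dot3 (toR z) u| < |dot3 (toR x) u| → nrm (toR y) ≤ nrm (toR z) := by
    intro x hx
    have hpos : 0 < |dot3 (toR x) u| := abs_pos.2 (hL x hx)
    obtain ⟨N, hN1, hN⟩ := rpow_small A (-(γ + 1)) (|dot3 (toR x) u| / 2) (by linarith)
      (by linarith)
    obtain ⟨y0, hy0, _, hy2⟩ := hs N hN1
    have hy3 := hN N le_rfl
    let S : Set (Fin 3 → ℤ) := {y | y ≠ 0 ∧ |dot3 (toR y) u| < |dot3 (toR x) u| ∧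
      nrm (toR y) ≤ nrm (toR y0)}
    have hy0S : y0 ∈ S := ⟨hy0, by linarith, le_rfl⟩
    have hfin : S.Finite := (finite_ball (nrm (toR y0))).subset (fun y hy => hy.2.2)
    obtain ⟨y, hyS, hymin⟩ := Set.exists_min_image S (fun y => nrm (toR y)) hfin ⟨y0, hy0S⟩
    refine ⟨y, hyS.1, hyS.2.1, ?_⟩
    intro z hz hz2
    by_cases hzn : nrm (toR z) ≤ nrm (toR y0)
    · exact hymin z ⟨hz, hz2, hzn⟩
    · exact (hymin y0 hy0S).trans (not_le.1 hzn).le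
  choose! f hf0 hf1 hf2 using next
  let x0 : Fin 3 → ℤ := fun _ => 1
  have hx0 : x0 ≠ 0 := by
    intro h
    have := congrFun h 0
    simp [x0] at this
  let s : ℕ → Fin 3 → ℤ := fun k => f^[k + 1] x0
  have hiter : ∀ k, f^[k] x0 ≠ 0 := by
    intro k
    induction k with
    | zero => exact hx0
    | succ k ih => rw [Function.iterate_succ_apply']; exact hf0 _ ih
  have hsucc : ∀ k, s (k + 1) = f (s k) := fun k => Function.iterate_succ_apply' f (k + 1) x0
  have hs0 : ∀ k, s k ≠ 0 := fun k => hiter (k + 1)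
  have hdec : ∀ k, |dot3 (toR (s (k + 1))) u| < |dot3 (toR (s k)) u| := by
    intro k
    rw [hsucc]
    exact hf1 _ (hs0 k)
  have hmono : ∀ k, nrm (toR (s k)) ≤ nrm (toR (s (k + 1))) := by
    intro k
    have e : s k = f (f^[k] x0) := Function.iterate_succ_apply' f k x0
    have h1 := hf2 _ (hiter k) (s (k + 1)) (hs0 _) (by
      refine (hdec k).trans ?_
      rw [e]
      exact hf1 _ (hiter k))
    rw [e] at *
    exact h1
  have hmono' : Monotone (fun k => nrm (toR (s k))) := monotone_nat_of_le_succ hmono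
  have hanti : StrictAnti (fun k => |dot3 (toR (s k)) u|) := strictAnti_nat_of_succ_lt hdec
  have hinj : Function.Injective s := by
    intro i j hij
    apply hanti.injective
    simp only [hij]
  have htend : Filter.Tendsto (fun k => nrm (toR (s k))) Filter.atTop Filter.atTop := by
    apply Filter.tendsto_atTop_atTop_of_monotone hmono'
    intro R
    by_contra hcon
    push Not at hcon
    apply Set.infinite_range_of_injective hinj
    apply (finite_ball R).subset
    rintro _ ⟨k, rfl⟩
    exact (hcon k).le
  refine ⟨s, A * (2 * D) ^ (γ + 1) + 1, ?_, hs0, hdec, hmono, htend, ?_⟩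
  · obtain ⟨y, hy, _, h2⟩ := hs 1 le_rfl
    have : 0 ≤ A := by
      have := abs_nonneg (dot3 (toR y) u)
      simp at h2
      linarith
    positivity
  · have h1 := htend.eventually (Filter.eventually_ge_atTop (2 * D))
    filter_upwards [h1] with k hk
    have hk' : 2 * D ≤ nrm (toR (s (k + 1))) := hk.trans (hmono k)
    set n := nrm (toR (s (k + 1))) with hn
    have hn0 : 0 < n := by linarith
    obtain ⟨y, hy, hy1, hy2⟩ := hs (n / (2 * D)) (by rw [le_div_iff₀ (by positivity)]; linarith)
    have hyn : nrm (toR y) < n := by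
      refine hy1.trans_lt ?_
      have : D * (n / (2 * D)) = n / 2 := by field_simp
      linarith
    have h2 : |dot3 (toR (s k)) u| ≤ |dot3 (toR y) u| := by
      by_contra hcon
      push Not at hcon
      have := hf2 _ (hs0 k) y hy hcon
      rw [← hsucc] at this
      linarith
    refine h2.trans (hy2.trans ?_)
    rw [Real.div_rpow hn0.le (by positivity), Real.rpow_neg (by positivity : 0 ≤ 2 * D),
      div_inv_eq_mul]
    have : 0 < n ^ (-(γ + 1)) := by positivity
    nlinarith

lemma toR_crossZ (x y : Fin 3 → ℤ) : toR (crossZ x y) = cross3 (toR x) (toR y) := by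
  funext i
  fin_cases i <;> simp [toR, crossZ, cross3]

lemma toR_ne_zero {x : Fin 3 → ℤ} (hx : x ≠ 0) : toR x ≠ 0 := by
  intro h
  apply hx
  funext i
  have := congrFun h i
  simpa [toR] using this

/-- Consecutive minimal points are not proportional. -/
lemma cross_ne (u x y : Fin 3 → ℝ) (hx : 0 < nrm x) (hxy : nrm x ≤ nrm y)
    (hl : |dot3 y u| < |dot3 x u|) : cross3 x y ≠ 0 := by
  intro h
  have c0 : x 1 * y 2 - x 2 * y 1 = 0 := by simpa [cross3] using congrFun h 0
  have c1 : x 2 * y 0 - x 0 * y 2 = 0 := by simpa [cross3] using congrFun h 1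
  have c2 : x 0 * y 1 - x 1 * y 0 = 0 := by simpa [cross3] using congrFun h 2
  -- (x·x) (y·u) = (x·y)(x·u), (x·y)^2 = (x·x)(y·y)
  have e1 : dot3 x x * dot3 y u = dot3 x y * dot3 x u := by
    simp only [dot3]
    linear_combination (x 1 * u 2 - x 2 * u 1) * c0 + (x 2 * u 0 - x 0 * u 2) * c1 +
      (x 0 * u 1 - x 1 * u 0) * c2
  have e2 : dot3 x y ^ 2 = dot3 x x * dot3 y y := by
    simp only [dot3]
    linear_combination (-(x 1 * y 2 - x 2 * y 1)) * c0 - (x 2 * y 0 - x 0 * y 2) * c1 -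
      (x 0 * y 1 - x 1 * y 0) * c2
  rw [← nrm_sq, ← nrm_sq] at e2
  rw [← nrm_sq] at e1
  have e3 : |dot3 x y| = nrm x * nrm y := by
    rw [← Real.sqrt_sq_eq_abs, e2, ← mul_pow, Real.sqrt_sq (mul_nonneg (nrm_nonneg _) (nrm_nonneg _))]
  have e4 : nrm x ^ 2 * |dot3 y u| = nrm x * nrm y * |dot3 x u| := by
    rw [← e3, ← abs_mul, ← e1, abs_mul, abs_of_nonneg (sq_nonneg (nrm x))]
  have e5 : nrm x * (nrm x * |dot3 y u|) = nrm x * (nrm y * |dot3 x u|) := by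
    linarith
  have e6 := mul_left_cancel₀ hx.ne' e5
  have e7 : nrm x * |dot3 x u| ≤ nrm y * |dot3 x u| := by gcongr
  nlinarith

lemma parallel_facts (m k : Fin 3 → ℝ) (h : cross3 m k = 0) :
    (∀ v, dot3 k k * dot3 m v = dot3 m k * dot3 k v) ∧
    (∀ v, dot3 m m * dot3 (cross3 k v) (cross3 k v) =
      dot3 k k * dot3 (cross3 m v) (cross3 m v)) := by
  have c0 : m 1 * k 2 - m 2 * k 1 = 0 := by simpa [cross3] using congrFun h 0
  have c1 : m 2 * k 0 - m 0 * k 2 = 0 := by simpa [cross3] using congrFun h 1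
  have c2 : m 0 * k 1 - m 1 * k 0 = 0 := by simpa [cross3] using congrFun h 2
  have h1 : ∀ v, dot3 k k * dot3 m v = dot3 m k * dot3 k v := by
    intro v
    simp only [dot3]
    linear_combination (k 2 * v 1 - k 1 * v 2) * c0 + (k 0 * v 2 - k 2 * v 0) * c1 +
      (k 1 * v 0 - k 0 * v 1) * c2
  refine ⟨h1, ?_⟩
  intro v
  have lag : ∀ a : Fin 3 → ℝ, dot3 (cross3 a v) (cross3 a v)
      = dot3 a a * dot3 v v - dot3 a v ^ 2 := by
    intro a
    simp only [dot3, cross3, Matrix.cons_val]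
    ring
  have h2 : dot3 m m * dot3 k k = dot3 m k ^ 2 := by
    have := h1 m
    rw [mul_comm, this]
    simp only [dot3]; ring
  rw [lag, lag]
  by_cases hk : dot3 k k = 0
  · have hkz : ∀ i, k i = 0 := by
      have h0 := mul_self_nonneg (k 0)
      have h1 := mul_self_nonneg (k 1)
      have h2 := mul_self_nonneg (k 2)
      simp only [dot3] at hk
      have z0 : k 0 = 0 := mul_self_eq_zero.1 (by linarith)
      have z1 : k 1 = 0 := mul_self_eq_zero.1 (by linarith)
      have z2 : k 2 = 0 := mul_self_eq_zero.1 (by linarith)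
      intro i
      fin_cases i
      · exact z0
      · exact z1
      · exact z2
    simp [dot3, hkz]
  · apply mul_left_cancel₀ hk
    have h3 := h1 v
    linear_combination (-dot3 k v ^ 2) * h2 +
      (dot3 k k * dot3 m v + dot3 m k * dot3 k v) * h3

/-- Infinitely many linearly independent triples of consecutive points. -/
lemma indep (u : Fin 3 → ℝ)
    (hQ : ∀ a b c : ℚ, (a : ℝ) * u 0 + (b : ℝ) * u 1 + (c : ℝ) * u 2 = 0 →
      a = 0 ∧ b = 0 ∧ c = 0)
    (s : ℕ → Fin 3 → ℤ) (hs0 : ∀ k, s k ≠ 0)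
    (hdec : ∀ k, |dot3 (toR (s (k + 1))) u| < |dot3 (toR (s k)) u|)
    (hmono : ∀ k, nrm (toR (s k)) ≤ nrm (toR (s (k + 1))))
    (hlim : Filter.Tendsto (fun k => |dot3 (toR (s k)) u| * nrm (toR (s (k + 1))))
      Filter.atTop (nhds 0)) (N : ℕ) :
    ∃ k, N ≤ k ∧ det3Z (s k) (s (k + 1)) (s (k + 2)) ≠ 0 := by
  by_contra hcon
  push Not at hcon
  let K : ℕ → Fin 3 → ℤ := fun k => crossZ (s k) (s (k + 1))
  have hK : ∀ k, K k ≠ 0 := by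
    intro k h
    apply cross_ne u (toR (s k)) (toR (s (k + 1))) (by linarith [one_le_nrm (hs0 k)]) (hmono k)
      (hdec k)
    rw [← toR_crossZ]
    change toR (K k) = 0
    rw [h]
    funext i
    simp [toR]
  let m := toR (K N)
  have hpar : ∀ j, dot3 m (toR (s (N + j))) = 0 ∧ dot3 m (toR (s (N + j + 1))) = 0 ∧
      cross3 m (toR (K (N + j))) = 0 := by
    have tri : ∀ x y : Fin 3 → ℝ, dot3 m x = 0 → dot3 m y = 0 → cross3 m (cross3 x y) = 0 := by
      intro x y hx hy
      simp only [dot3] at hx hy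
      funext i
      fin_cases i <;> simp [cross3]
      · linear_combination x 0 * hy - y 0 * hx
      · linear_combination x 1 * hy - y 1 * hx
      · linear_combination x 2 * hy - y 2 * hx
    intro j
    induction j with
    | zero =>
      have a1 : dot3 m (toR (s (N + 0))) = 0 := by
        simp only [m, K, toR_crossZ, dot3, cross3, Matrix.cons_val, add_zero]; ring
      have a2 : dot3 m (toR (s (N + 0 + 1))) = 0 := by
        simp only [m, K, toR_crossZ, dot3, cross3, Matrix.cons_val, add_zero]; ring
      refine ⟨a1, a2, ?_⟩
      simp only [K, toR_crossZ]
      exact tri _ _ a1 a2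
    | succ j ih =>
      obtain ⟨i1, i2, i3⟩ := ih
      have hd := hcon (N + j) (by lia)
      have hd' : dot3 (toR (K (N + j))) (toR (s (N + j + 2))) = 0 := by
        have : ((det3Z (s (N + j)) (s (N + j + 1)) (s (N + j + 2)) : ℤ) : ℝ) = 0 := by
          rw [hd]; simp
        simp only [det3Z] at this
        push_cast at this
        simp only [K, toR_crossZ]
        simp only [dot3, cross3, Matrix.cons_val, toR]
        linarith
      have h1 := (parallel_facts m _ i3).1 (toR (s (N + j + 2)))
      rw [hd', mul_zero] at h1
      have hkk : dot3 (toR (K (N + j))) (toR (K (N + j))) ≠ 0 := by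
        rw [← nrm_sq]
        have := one_le_nrm (hK (N + j))
        positivity
      have a2 : dot3 m (toR (s (N + (j + 1) + 1))) = 0 := (mul_eq_zero.1 h1).resolve_left hkk
      have a1 : dot3 m (toR (s (N + (j + 1)))) = 0 := i2
      refine ⟨a1, a2, ?_⟩
      simp only [K, toR_crossZ]
      exact tri _ _ a1 a2
  -- m × u ≠ 0
  have hmu : 0 < nrm (cross3 m u) := by
    rcases (nrm_nonneg (cross3 m u)).lt_or_eq with h | h
    · exact h
    exfalso
    have h2 : dot3 (cross3 m u) (cross3 m u) = 0 := by rw [← nrm_sq, ← h]; norm_num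
    simp only [dot3, cross3, Matrix.cons_val] at h2
    have n0 := mul_self_nonneg (m 1 * u 2 - m 2 * u 1)
    have n1 := mul_self_nonneg (m 2 * u 0 - m 0 * u 2)
    have n2 := mul_self_nonneg (m 0 * u 1 - m 1 * u 0)
    have z0 : m 1 * u 2 - m 2 * u 1 = 0 := mul_self_eq_zero.1 (by linarith)
    have z2 : m 0 * u 1 - m 1 * u 0 = 0 := mul_self_eq_zero.1 (by linarith)
    have q0 := hQ 0 (-(K N 2 : ℚ)) (K N 1 : ℚ) (by
      push_cast; simp only [m, toR] at z0; linarith)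
    have q2 := hQ (-(K N 1 : ℚ)) (K N 0 : ℚ) 0 (by
      push_cast; simp only [m, toR] at z2; linarith)
    apply hK N
    funext i
    fin_cases i
    · simpa using q2.2.1
    · simpa using q0.2.2
    · simpa using q0.2.1
  have hm1 : 1 ≤ nrm m := one_le_nrm (hK N)
  set c := nrm (cross3 m u) / nrm m with hc
  have hc0 : 0 < c := by positivity
  have hlow : ∀ k, N ≤ k → c ≤ 2 * (|dot3 (toR (s k)) u| * nrm (toR (s (k + 1)))) := by
    intro k hk
    obtain ⟨j, rfl⟩ := Nat.exists_eq_add_of_le hk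
    have hp := (hpar j).2.2
    have h1 := (parallel_facts m _ hp).2 u
    have hk1 := one_le_nrm (hK (N + j))
    simp only [← nrm_sq] at h1
    set x := toR (s (N + j)) with hxdef
    set y := toR (s (N + j + 1)) with hydef
    have hKe : toR (K (N + j)) = cross3 x y := toR_crossZ _ _
    have h2 : c ≤ nrm (cross3 (toR (K (N + j))) u) := by
      rw [hc, div_le_iff₀ (by linarith)]
      apply le_of_sq_le_sq
      · rw [mul_pow, mul_comm, h1]
        apply le_mul_of_one_le_left (sq_nonneg _)
        exact one_le_pow₀ hk1
      · exact mul_nonneg (nrm_nonneg _) (nrm_nonneg _)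
    refine h2.trans ?_
    rw [hKe]
    have hl := (hdec (N + j)).le
    have hn := hmono (N + j)
    rw [← hxdef, ← hydef] at hl hn
    -- (x×y)×u = (x·u) y - (y·u) x
    apply le_of_sq_le_sq
    · have e : nrm (cross3 (cross3 x y) u) ^ 2 = dot3 x u ^ 2 * nrm y ^ 2
          - 2 * (dot3 x u * dot3 y u * dot3 x y) + dot3 y u ^ 2 * nrm x ^ 2 := by
        simp only [nrm_sq, dot3, cross3, Matrix.cons_val]; ring
      have cs : |dot3 x y| ≤ nrm x * nrm y := by
        apply abs_le_of_sq_le_sq _ (mul_nonneg (nrm_nonneg _) (nrm_nonneg _))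
        rw [mul_pow, nrm_sq, nrm_sq]
        have : dot3 x x * dot3 y y - dot3 x y ^ 2 = dot3 (cross3 x y) (cross3 x y) := by
          simp only [dot3, cross3, Matrix.cons_val]; ring
        rw [← nrm_sq (cross3 x y)] at this
        have := sq_nonneg (nrm (cross3 x y))
        linarith
      have hx0 := nrm_nonneg x
      have hy0 := nrm_nonneg y
      have cs2 : |dot3 x y| ≤ nrm y * nrm y :=
        cs.trans (mul_le_mul_of_nonneg_right hn hy0)
      have t1 : -(dot3 x u * dot3 y u * dot3 x y) ≤ |dot3 x u| * |dot3 x u| * (nrm y * nrm y) := by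
        refine (neg_le_abs _).trans ?_
        rw [abs_mul, abs_mul]
        gcongr
      have t2 : dot3 y u ^ 2 * nrm x ^ 2 ≤ dot3 x u ^ 2 * nrm y ^ 2 := by
        rw [← sq_abs (dot3 y u), ← sq_abs (dot3 x u)]
        gcongr
      have t3 : |dot3 x u| * |dot3 x u| = dot3 x u ^ 2 := by rw [← sq, sq_abs]
      rw [t3] at t1
      rw [e, mul_pow, mul_pow, sq_abs]
      linarith
    · have := nrm_nonneg y
      positivity
  have hev := hlim.eventually (gt_mem_nhds (show 0 < c / 2 by positivity))
  obtain ⟨k, hk1, hk2⟩ := (hev.and (Filter.eventually_ge_atTop N)).exists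
  have := hlow k hk2
  linarith

/-- The theorem for orthonormal `u`, `d` and small `δ`. -/
lemma core (u d : Fin 3 → ℝ) (huu : dot3 u u = 1) (hdd : dot3 d d = 1)
    (hud : dot3 u d = 0)
    (hQ : ∀ a b c : ℚ, (a : ℝ) * u 0 + (b : ℝ) * u 1 + (c : ℝ) * u 2 = 0 →
      a = 0 ∧ b = 0 ∧ c = 0)
    (δ ε : ℝ) (hδ : 0 < δ) (hδ2 : δ ≤ 1 / 2) (hε : 0 < ε) :
    ∃ x : Fin 3 → ℤ, x ≠ 0 ∧ dot3 (toR x) (cross3 u d) ^ 2 + dot3 (toR x) u ^ 2 ≤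
      δ ^ 2 * nrm (toR x) ^ 2 ∧ |dot3 (toR x) u| ≤ ε * nrm (toR x) ^ (-γ) := by
  by_contra hcon
  push Not at hcon
  have hg := gamma_gt
  obtain ⟨D, A, hD, hA, hs⟩ := star u d huu hdd hud δ ε hδ hδ2 hε hcon
  have hL : ∀ x : Fin 3 → ℤ, x ≠ 0 → dot3 (toR x) u ≠ 0 := by
    intro x hx h
    have h1 := hQ (x 0) (x 1) (x 2) (by simpa [dot3, toR] using h)
    apply hx
    funext i
    fin_cases i
    · simpa using h1.1
    · simpa using h1.2.1
    · simpa using h1.2.2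
  obtain ⟨s, C, hC, hs0, hdec, hmono, htend, hev⟩ := minseq u hL D A hD hs
  have htend1 : Filter.Tendsto (fun k => nrm (toR (s (k + 1)))) Filter.atTop Filter.atTop :=
    htend.comp (Filter.tendsto_add_atTop_nat 1)
  have hlim : Filter.Tendsto (fun k => |dot3 (toR (s k)) u| * nrm (toR (s (k + 1))))
      Filter.atTop (nhds 0) := by
    have h1 : Filter.Tendsto (fun k => C * nrm (toR (s (k + 1))) ^ (-γ))
        Filter.atTop (nhds 0) := by
      have := ((tendsto_rpow_neg_atTop (y := γ) (by linarith)).comp htend1).const_mul C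
      simpa using this
    refine tendsto_of_tendsto_of_tendsto_of_le_of_le' tendsto_const_nhds h1 ?_ ?_
    · exact Filter.Eventually.of_forall fun k => mul_nonneg (abs_nonneg _) (nrm_nonneg _)
    · filter_upwards [hev] with k hk
      have hn := one_le_nrm (hs0 (k + 1))
      have hn0 : 0 < nrm (toR (s (k + 1))) := by linarith
      calc _ ≤ C * nrm (toR (s (k + 1))) ^ (-(γ + 1)) * nrm (toR (s (k + 1))) := by gcongr
        _ = C * nrm (toR (s (k + 1))) ^ (-γ) := by
          rw [mul_assoc, ← Real.rpow_add_one hn0.ne']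
          ring_nf
  obtain ⟨N1, hN1, hN1'⟩ := rpow_small C (1 - γ) (δ / 8) (by linarith) (by positivity)
  have hb1 := htend.eventually (Filter.eventually_ge_atTop N1)
  have hb2 := htend.eventually (Filter.eventually_ge_atTop (C / ε))
  have hb3 := htend.eventually (Filter.eventually_ge_atTop (4 * C * (8 / δ) ^ γ / (δ * ε)))
  obtain ⟨N, hN⟩ := Filter.eventually_atTop.1 (hev.and (hb1.and (hb2.and hb3)))
  obtain ⟨k, hk, hdetk⟩ := indep u hQ s hs0 hdec hmono hlim N
  obtain ⟨hw, -, -, -⟩ := hN k hk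
  obtain ⟨hx, hx1, hx2, hx3⟩ := hN (k + 1) (by lia)
  have hXY := hmono (k + 1)
  have hWX := hmono k
  have hlyx := (hdec (k + 1)).le
  have hX1 := one_le_nrm (hs0 (k + 1))
  have hdist := hcon (s (k + 1)) (hs0 _)
  have hdet : 1 ≤ |det3 (toR (s k)) (toR (s (k + 1))) (toR (s (k + 2)))| := by
    have : det3 (toR (s k)) (toR (s (k + 1))) (toR (s (k + 2)))
        = ((det3Z (s k) (s (k + 1)) (s (k + 2)) : ℤ) : ℝ) := by
      simp only [det3, det3Z, toR]; push_cast; ring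
    rw [this]
    exact_mod_cast Int.one_le_abs hdetk
  rw [det_expand u d _ _ _ huu hdd hud] at hdet
  have Ew := norm_expand u d (toR (s k)) huu hdd hud
  have Ex := norm_expand u d (toR (s (k + 1))) huu hdd hud
  have Ey := norm_expand u d (toR (s (k + 2))) huu hdd hud
  have hW0 := nrm_nonneg (toR (s k))
  rw [show k + 1 + 1 = k + 2 from rfl] at hx hXY hlyx
  have lin : ∀ (a : ℤ) (v : Fin 3 → ℝ), dot3 (toR (s (k + 2) - a • s (k + 1))) v =
      dot3 (toR (s (k + 2))) v - a * dot3 (toR (s (k + 1))) v := by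
    intro a v
    simp only [dot3, toR, Pi.sub_apply, Pi.smul_apply, smul_eq_mul]
    push_cast
    ring
  set W := nrm (toR (s k))
  set X := nrm (toR (s (k + 1)))
  set Y := nrm (toR (s (k + 2)))
  set lx := dot3 (toR (s (k + 1))) u
  have hX0 : 0 < X := by linarith
  have hY0 : 0 < Y := by linarith
  have pw2 : ∀ Z : ℝ, 0 < Z → C * Z ^ (-(γ + 1)) * Z ^ 2 = C * Z ^ (1 - γ) := by
    intro Z hZ
    rw [mul_assoc, ← Real.rpow_natCast, ← Real.rpow_add hZ]
    congr 2
    push_cast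
    ring
  have pw1 : Y ^ (-(γ + 1)) = Y ^ (-γ) / Y := by
    rw [show -(γ + 1) = -γ - 1 by ring, Real.rpow_sub_one hY0.ne']
  have c1 : |dot3 (toR (s k)) u| * X ^ 2 ≤ δ / 8 := by
    calc _ ≤ C * X ^ (-(γ + 1)) * X ^ 2 := by gcongr
      _ = C * X ^ (1 - γ) := pw2 X hX0
      _ ≤ _ := hN1' X hx1
  have c2 : |lx| * Y ^ 2 ≤ δ / 8 := by
    calc _ ≤ C * Y ^ (-(γ + 1)) * Y ^ 2 := by gcongr
      _ = C * Y ^ (1 - γ) := pw2 Y hY0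
      _ ≤ _ := hN1' Y (hx1.trans hXY)
  have c3 : |lx| ≤ ε * X ^ (-γ) := by
    have e1 : Y ^ (-(γ + 1)) ≤ X ^ (-(γ + 1)) :=
      Real.rpow_le_rpow_of_nonpos hX0 hXY (by linarith)
    have e2 : X ^ (-(γ + 1)) = X ^ (-γ) / X := by
      rw [show -(γ + 1) = -γ - 1 by ring, Real.rpow_sub_one hX0.ne']
    have e3 : C ≤ ε * X := by
      rw [div_le_iff₀ hε] at hx2; linarith
    calc |lx| ≤ C * Y ^ (-(γ + 1)) := hx
      _ ≤ C * X ^ (-(γ + 1)) := by gcongr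
      _ = C * (X ^ (-γ) / X) := by rw [e2]
      _ ≤ (ε * X) * (X ^ (-γ) / X) := by gcongr
      _ = ε * X ^ (-γ) := by field_simp
  have c4 : δ ^ 2 * X ^ 2 < dot3 (toR (s (k + 1))) (cross3 u d) ^ 2 + lx ^ 2 := by
    by_contra h
    have := hdist (not_lt.1 h)
    linarith
  obtain ⟨a, ha0, ha1, ha2, ha3⟩ := poly_step δ W X Y _ _ _ _ _ _ _ _ _ hδ hδ2 hX1 hW0 hWX hXY
    Ew Ex Ey c1 c2 hlyx hdet c4
  simp only [lx] at ha1 ha2 ha3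
  rw [← lin, ← lin, ← lin] at ha1
  rw [← lin] at ha0 ha2
  rw [← lin, ← lin, ← lin] at ha3
  set z := s (k + 2) - a • s (k + 1)
  have hz0 : z ≠ 0 := by
    intro h
    apply ha0
    rw [h]
    simp [dot3, toR]
  have Ez := norm_expand u d (toR z) huu hdd hud
  rw [← Ez] at ha3
  have hzn : nrm (toR z) ≤ 8 * Y / δ := le_of_sq_le_sq ha3 (by positivity)
  have hz1 := one_le_nrm hz0
  have hfin := hcon z hz0 (by
    refine ha1.trans ?_
    apply mul_le_mul_of_nonneg_left _ (sq_nonneg δ)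
    rw [Ez]
    linarith [sq_nonneg (dot3 (toR z) (cross3 u d)), sq_nonneg (dot3 (toR z) u)])
  have f1 : (8 * Y / δ) ^ (-γ) ≤ nrm (toR z) ^ (-γ) :=
    Real.rpow_le_rpow_of_nonpos (by linarith) hzn (by linarith)
  have f2 : (8 * Y / δ) ^ (-γ) = Y ^ (-γ) / (8 / δ) ^ γ := by
    rw [show 8 * Y / δ = (8 / δ) * Y by ring, Real.mul_rpow (by positivity) hY0.le,
      Real.rpow_neg (by positivity : (0 : ℝ) ≤ 8 / δ)]
    field_simp
  have hG : 0 < (8 / δ) ^ γ := by positivity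
  have hYg : 0 < Y ^ (-γ) := by positivity
  have f3 : 4 * Y / (δ * X) * |lx| ≤ ε * (Y ^ (-γ) / (8 / δ) ^ γ) := by
    calc 4 * Y / (δ * X) * |lx| ≤ 4 * Y / (δ * X) * (C * (Y ^ (-γ) / Y)) := by
          rw [← pw1]; gcongr
      _ = 4 * C / (δ * X) * Y ^ (-γ) := by field_simp
      _ ≤ ε / (8 / δ) ^ γ * Y ^ (-γ) := by
          apply mul_le_mul_of_nonneg_right _ hYg.le
          rw [div_le_iff₀ (by positivity)] at hx3
          rw [div_le_div_iff₀ (by positivity) hG]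
          linarith
      _ = _ := by ring
  have f4 : ε * (8 * Y / δ) ^ (-γ) ≤ ε * nrm (toR z) ^ (-γ) := by gcongr
  rw [f2] at f4
  linarith

lemma nrm_pos {v : Fin 3 → ℝ} (hv : v ≠ 0) : 0 < nrm v := by
  rcases (nrm_nonneg v).lt_or_eq with h | h
  · exact h
  exfalso
  have h2 : dot3 v v = 0 := by rw [← nrm_sq, ← h]; norm_num
  simp only [dot3] at h2
  have n0 := mul_self_nonneg (v 0)
  have n1 := mul_self_nonneg (v 1)
  have n2 := mul_self_nonneg (v 2)
  have z0 : v 0 = 0 := mul_self_eq_zero.1 (by linarith)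
  have z1 : v 1 = 0 := mul_self_eq_zero.1 (by linarith)
  have z2 : v 2 = 0 := mul_self_eq_zero.1 (by linarith)
  apply hv
  funext i
  fin_cases i
  · exact z0
  · exact z1
  · exact z2

/-- Schmidt's Theorem B. -/
theorem stmt11 (u d : Fin 3 → ℝ) (hud : dot3 u d = 0) (hd : d ≠ 0)
    (hQ : ∀ a b c : ℚ, (a : ℝ) * u 0 + (b : ℝ) * u 1 + (c : ℝ) * u 2 = 0 →
      a = 0 ∧ b = 0 ∧ c = 0)
    (δ ε : ℝ) (hδ : 0 < δ) (hε : 0 < ε) :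
    ∃ x : Fin 3 → ℤ, x ≠ 0 ∧ pdist (toR x) d ≤ δ ∧
      |dot3 (toR x) u| ≤ ε * nrm (toR x) ^ (-γ) := by

  have hu : u ≠ 0 := by
    intro h
    have := (hQ 1 0 0 (by simp [h])).1
    norm_num at this
  have hun := nrm_pos hu
  have hdn := nrm_pos hd
  set U := nrm u with hU
  set E := nrm d with hE
  have hU2 : U ^ 2 = dot3 u u := nrm_sq u
  have hE2 : E ^ 2 = dot3 d d := nrm_sq d
  let u' : Fin 3 → ℝ := fun i => U⁻¹ * u i
  let d' : Fin 3 → ℝ := fun i => E⁻¹ * d i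
  have huu : dot3 u' u' = 1 := by
    have : dot3 u' u' = U⁻¹ ^ 2 * dot3 u u := by simp only [dot3, u']; ring
    rw [this, ← hU2]
    field_simp
  have hdd : dot3 d' d' = 1 := by
    have : dot3 d' d' = E⁻¹ ^ 2 * dot3 d d := by simp only [dot3, d']; ring
    rw [this, ← hE2]
    field_simp
  have hud' : dot3 u' d' = 0 := by
    have : dot3 u' d' = U⁻¹ * E⁻¹ * dot3 u d := by simp only [dot3, u', d']; ring
    rw [this, hud, mul_zero]
  obtain ⟨x, hx0, h1, h2⟩ := core u' d' huu hdd hud' (by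
      intro a b c h
      apply hQ
      have : U⁻¹ * ((a : ℝ) * u 0 + b * u 1 + c * u 2) = 0 := by
        rw [← h]; simp only [u']; ring
      exact (mul_eq_zero.1 this).resolve_left (inv_pos.2 hun).ne')
    (min δ (1 / 2)) (ε / U) (lt_min hδ (by norm_num)) (min_le_right _ _) (by positivity)
  have hn := one_le_nrm hx0
  refine ⟨x, hx0, ?_, ?_⟩
  · rw [← cross_expand u' d' _ huu hdd hud', ← mul_pow] at h1
    have hm : 0 < min δ (1 / 2) := lt_min hδ (by norm_num)
    have h3 : nrm (cross3 (toR x) d') ≤ min δ (1 / 2) * nrm (toR x) :=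
      le_of_sq_le_sq h1 (mul_nonneg hm.le (nrm_nonneg _))
    have h4 : nrm (cross3 (toR x) d) = E * nrm (cross3 (toR x) d') := by
      have e : dot3 (cross3 (toR x) d) (cross3 (toR x) d) =
          E ^ 2 * dot3 (cross3 (toR x) d') (cross3 (toR x) d') := by
        simp only [dot3, cross3, d', Matrix.cons_val]
        field_simp
      unfold nrm at *
      rw [e, Real.sqrt_mul (sq_nonneg E), Real.sqrt_sq hdn.le]
    unfold pdist
    rw [h4, div_le_iff₀ (by positivity)]
    have h5 : min δ (1 / 2) * nrm (toR x) ≤ δ * nrm (toR x) := by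
      gcongr
      exact min_le_left _ _
    calc E * nrm (cross3 (toR x) d') ≤ E * (δ * nrm (toR x)) := by
          gcongr
          exact h3.trans h5
      _ = _ := by ring
  · have e : dot3 (toR x) u = U * dot3 (toR x) u' := by
      simp only [dot3, u']; field_simp
    rw [e, abs_mul, abs_of_pos hun]
    calc U * |dot3 (toR x) u'| ≤ U * (ε / U * nrm (toR x) ^ (-γ)) := by gcongr
      _ = _ := by field_simp
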